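/- Let A ∈ B(H). If w(A) = ‖A‖/2, then ‖Re(A)‖ = ‖Im(A)‖ = ‖A‖/2. -/

import Mathlib

open ContinuousLinearMap Filter
open scoped ComplexInnerProductSpace Topology

variable {H : Type*} [NormedAddCommGroup H] [InnerProductSpace ℂ H]
  [CompleteSpace H] [Nontrivial H]

/-- The numerical range of a bounded linear operator. -/
noncomputable def numRange (A : H →L[ℂ] H) : Set ℂ :=
  {z : ℂ | ∃ x : H, ‖x‖ = 1 ∧ z = ⟪x, A x⟫}

/-- The numerical radius of a bounded linear operator. -/
noncomputable def numRadius (A : H →L[ℂ] H) : ℝ :=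
  sSup {r : ℝ | ∃ x : H, ‖x‖ = 1 ∧ r = ‖(⟪x, A x⟫)‖}

/-- The Crawford number of a bounded linear operator. -/
noncomputable def crawford (A : H →L[ℂ] H) : ℝ :=
  sInf {r : ℝ | ∃ x : H, ‖x‖ = 1 ∧ r = ‖(⟪x, A x⟫)‖}

/-- The real part `(A + A*)/2` of a bounded linear operator. -/
noncomputable def reOp (A : H →L[ℂ] H) : H →L[ℂ] H :=
  (2 : ℂ)⁻¹ • (A + ContinuousLinearMap.adjoint A)

/-- The imaginary part `(A - A*)/(2i)` of a bounded linear operator. -/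
noncomputable def imOp (A : H →L[ℂ] H) : H →L[ℂ] H :=
  (2 * Complex.I)⁻¹ • (A - ContinuousLinearMap.adjoint A)

theorem norm_inner_le_numRadius (A : H →L[ℂ] H) {x : H} (hx : ‖x‖ = 1) :
    ‖⟪x, A x⟫‖ ≤ numRadius A := by
  refine le_csSup ⟨‖A‖, ?_⟩ ⟨x, hx, rfl⟩
  rintro _ ⟨y, hy, rfl⟩
  calc ‖⟪y, A y⟫‖ ≤ ‖y‖ * ‖A y‖ := norm_inner_le_norm y (A y)
    _ ≤ ‖A‖ := by simpa [hy] using A.le_opNorm y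

theorem norm_le_of_isSelfAdjoint_of_norm_inner_le {T : H →L[ℂ] H} (hT : IsSelfAdjoint T) {M : ℝ}
    (hM : ∀ x : H, ‖x‖ = 1 → ‖⟪x, T x⟫‖ ≤ M) : ‖T‖ ≤ M := by
  rw [T.norm_eq_iSup_rayleighQuotient hT.isSymmetric]
  refine ciSup_le fun x => ?_
  by_cases hx : x = 0
  · obtain ⟨y, hy⟩ := exists_norm_eq H zero_le_one
    simpa [hx] using (norm_nonneg _).trans (hM y hy)
  · have hc : ((‖x‖ : ℂ)⁻¹) ≠ 0 := by simpa using hx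
    have hn : ‖(‖x‖ : ℂ)⁻¹ • x‖ = 1 := norm_smul_inv_norm hx
    rw [← T.rayleigh_smul x hc, ContinuousLinearMap.rayleighQuotient, hn, one_pow, div_one,
      ContinuousLinearMap.reApplyInnerSelf_apply]
    refine (RCLike.abs_re_le_norm _).trans ?_
    rw [norm_inner_symm]
    exact hM _ hn

theorem isSelfAdjoint_reOp (A : H →L[ℂ] H) : IsSelfAdjoint (reOp A) := by
  simp [IsSelfAdjoint, reOp, ← ContinuousLinearMap.star_eq_adjoint, add_comm]

theorem reOp_add_I_smul_imOp (A : H →L[ℂ] H) : reOp A + Complex.I • imOp A = A := by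
  have hI : Complex.I * (2 * Complex.I)⁻¹ = (2 : ℂ)⁻¹ := by field_simp [Complex.I_ne_zero]
  rw [reOp, imOp, smul_smul, hI]
  module

theorem imOp_eq_reOp (A : H →L[ℂ] H) : imOp A = reOp (-Complex.I • A) := by
  have hI : (2 * Complex.I)⁻¹ = (2 : ℂ)⁻¹ * -Complex.I := by simp [mul_comm]
  rw [imOp, reOp, hI, map_smulₛₗ]
  simp only [map_neg, Complex.conj_I, neg_neg]
  module

theorem numRadius_smul_of_norm_eq_one (A : H →L[ℂ] H) {c : ℂ} (hc : ‖c‖ = 1) :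
    numRadius (c • A) = numRadius A := by
  simp [numRadius, hc]

theorem norm_reOp_le_numRadius (A : H →L[ℂ] H) : ‖reOp A‖ ≤ numRadius A := by
  refine norm_le_of_isSelfAdjoint_of_norm_inner_le (isSelfAdjoint_reOp A) fun x hx => ?_
  have hA := norm_inner_le_numRadius A hx
  have hadj : ‖⟪x, adjoint A x⟫‖ = ‖⟪x, A x⟫‖ := by
    rw [ContinuousLinearMap.adjoint_inner_right, norm_inner_symm]
  have hadd := norm_add_le ⟪x, A x⟫ ⟪x, adjoint A x⟫
  simp only [reOp, smul_apply, add_apply, inner_smul_right, inner_add_right, norm_mul,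
    norm_inv, Complex.norm_ofNat]
  linarith

theorem norm_imOp_le_numRadius (A : H →L[ℂ] H) : ‖imOp A‖ ≤ numRadius A := by
  rw [imOp_eq_reOp, ← numRadius_smul_of_norm_eq_one A (c := -Complex.I) (by simp)]
  exact norm_reOp_le_numRadius _

/-- If `w(A) = ‖A‖/2`, then `‖Re(A)‖ = ‖Im(A)‖ = ‖A‖/2`. -/
theorem stmt2 (A : H →L[ℂ] H) (h : numRadius A = ‖A‖ / 2) :
    ‖reOp A‖ = ‖A‖ / 2 ∧ ‖imOp A‖ = ‖A‖ / 2 := by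
  have hre := norm_reOp_le_numRadius A
  have him := norm_imOp_le_numRadius A
  have htri : ‖A‖ ≤ ‖reOp A‖ + ‖imOp A‖ := by
    simpa [reOp_add_I_smul_imOp, norm_smul] using norm_add_le (reOp A) (Complex.I • imOp A)
  constructor <;> linarith
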